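/- If G is a finite connected simple graph with at least one vertex and diameter diam(G), then γ_e(G) ≥ (diam(G) + 2)/4. -/

import Mathlib

open SimpleGraph

/-- The contribution `(1/2)^(d-1)` of a vertex at `S`-restricted distance `d`,
with `(1/2)^∞ = 0`. -/
noncomputable def expStep (d : ℕ∞) : ℝ :=
  if h : d = ⊤ then 0 else (1 / 2 : ℝ) ^ ((d.untop h : ℤ) - 1)

/-- `expDist G S u v` is the minimum number of edges of a walk in `G` from `u` to `v`
such that `v` is the only vertex of the walk belonging to `S` (i.e. the distance from `u`
to `v ∈ S` in `G - (S \ {v})`), and `⊤` if no such walk exists. -/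
noncomputable def expDist {V : Type*} (G : SimpleGraph V) (S : Finset V) (u v : V) : ℕ∞ :=
  sInf {n : ℕ∞ | ∃ p : G.Walk u v, (∀ x ∈ p.support, x ∈ S → x = v) ∧ (p.length : ℕ∞) = n}

/-- The weight `w_{(G,S)}(u) = Σ_{v ∈ S} (1/2)^(dist_{(G,S)}(u,v) - 1)`. -/
noncomputable def expWeight {V : Type*} (G : SimpleGraph V) (S : Finset V) (u : V) : ℝ :=
  ∑ v ∈ S, expStep (expDist G S u v)

/-- `S` is an exponential dominating set of `G`. -/
def IsExpDomSet {V : Type*} (G : SimpleGraph V) (S : Finset V) : Prop :=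
  ∀ u : V, 1 ≤ expWeight G S u

/-- The exponential domination number of `G`. -/
noncomputable def expDomNum {V : Type*} (G : SimpleGraph V) : ℕ :=
  sInf {k : ℕ | ∃ S : Finset V, IsExpDomSet G S ∧ S.card = k}

/-- The credit of a one-sided geometric potential `a ≥ 1`, used to amortize the gaps between
consecutive layers that meet the dominating set. -/
noncomputable def gapCredit (a : ℝ) : ℝ := max 0 (2 * (a - 13 / 12))

lemma gapCredit_nonneg (a : ℝ) : 0 ≤ gapCredit a := le_max_left _ _

lemma le_gapCredit (a : ℝ) : 2 * (a - 13 / 12) ≤ gapCredit a := le_max_right _ _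

lemma gapCredit_one_add_le {x : ℝ} (hx : 0 ≤ x) : gapCredit (1 + x) ≤ 2 * x :=
  max_le (by linarith) (by linarith)

lemma gapCredit_one : gapCredit 1 = 0 := by norm_num [gapCredit]

lemma gapCredit_one_add_of_le_four {g : ℕ} (hg : g ≤ 4) {a : ℝ} (ha : 1 ≤ a) :
    ((g : ℝ) - 4) / 2 + gapCredit (1 + (1 / 2) ^ g * a) ≤ gapCredit a := by
  have h0 := gapCredit_nonneg a
  have h1 := le_gapCredit a
  generalize gapCredit a = c at h0 h1 ⊢
  unfold gapCredit
  interval_cases g <;> rcases max_cases (0 : ℝ) (2 * (1 + (1 / 2) ^ _ * a - 13 / 12)) with h | h <;>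
    rw [h.1] <;> norm_num at h ⊢ <;> linarith

lemma two_mul_sub_two_le_two_pow {t : ℕ} (ht : 3 ≤ t) : 2 * (t : ℝ) - 2 ≤ 2 ^ (t - 1) := by
  induction t, ht using Nat.le_induction with
  | base => norm_num
  | succ n hn ih =>
    obtain ⟨k, rfl⟩ := Nat.exists_eq_add_of_le hn
    rw [show 3 + k + 1 - 1 = (3 + k - 1) + 1 by omega, pow_succ]
    push_cast at ih ⊢
    have : (0 : ℝ) ≤ k := k.cast_nonneg
    linarith

/-- A gap of length `g`, seen from potentials `a` and `b` at its two ends, all of whose interior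
points are dominated, is paid for by the loss of credit across the gap. -/
lemma gap_le_gapCredit {g : ℕ} {a b : ℝ} (ha : 1 ≤ a) (hb : 1 ≤ b)
    (hdom : ∀ y, 0 < y → y < g → 1 / 2 ≤ (1 / 2 : ℝ) ^ y * a + (1 / 2) ^ (g - y) * b) :
    (g : ℝ) - 4 + gapCredit (1 + (1 / 2) ^ g * a) + gapCredit (1 + (1 / 2) ^ g * b) ≤
      gapCredit a + gapCredit b := by
  rcases le_or_gt g 4 with hg | hg
  · linarith [gapCredit_one_add_of_le_four hg ha, gapCredit_one_add_of_le_four hg hb]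
  have hca := le_gapCredit a
  have hcb := le_gapCredit b
  rcases Nat.lt_or_ge g 6 with hg6 | hg6
  · obtain rfl : g = 5 := by omega
    have h2 := hdom 2 (by norm_num) (by norm_num)
    have h3 := hdom 3 (by norm_num) (by norm_num)
    norm_num at h2 h3 ⊢
    generalize gapCredit a = ca at *
    generalize gapCredit b = cb at *
    unfold gapCredit
    rcases max_cases (0 : ℝ) (2 * (1 + 1 / 32 * a - 13 / 12)) with h | h <;>
    rcases max_cases (0 : ℝ) (2 * (1 + 1 / 32 * b - 13 / 12)) with h' | h' <;>
    rw [h.1, h'.1] <;> linarith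
  · have hq : (1 / 2 : ℝ) ^ g ≤ 1 / 64 := by
      calc (1 / 2 : ℝ) ^ g ≤ (1 / 2) ^ 6 :=
            pow_le_pow_of_le_one (by norm_num) (by norm_num) hg6
        _ = 1 / 64 := by norm_num
    have hq0 : (0 : ℝ) ≤ (1 / 2) ^ g := by positivity
    have hka := gapCredit_one_add_le (mul_nonneg hq0 (by linarith : (0 : ℝ) ≤ a))
    have hkb := gapCredit_one_add_le (mul_nonneg hq0 (by linarith : (0 : ℝ) ≤ b))
    have hqa : (1 / 2 : ℝ) ^ g * a ≤ 1 / 64 * a := by gcongr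
    have hqb : (1 / 2 : ℝ) ^ g * b ≤ 1 / 64 * b := by gcongr
    obtain ⟨t, ht, hgt, htg⟩ : ∃ t, 3 ≤ t ∧ 2 * t ≤ g ∧ g ≤ 2 * t + 1 :=
      ⟨g / 2, by omega, by omega, by omega⟩
    have hmid := hdom t (by omega) (by omega)
    have hright : (1 / 2 : ℝ) ^ (g - t) ≤ (1 / 2) ^ t :=
      pow_le_pow_of_le_one (by norm_num) (by norm_num) (by omega)
    have hsum : (1 / 2 : ℝ) ≤ (1 / 2) ^ t * (a + b) := by nlinarith
    have hpow : (1 / 2 : ℝ) ^ t * 2 ^ (t - 1) = 1 / 2 := by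
      obtain ⟨k, rfl⟩ : ∃ k, t = k + 1 := ⟨t - 1, by omega⟩
      rw [Nat.add_sub_cancel, pow_succ, mul_right_comm, ← mul_pow]
      norm_num
    have hab : (2 : ℝ) ^ (t - 1) ≤ a + b := by
      have : (1 / 2 : ℝ) ^ t * 2 ^ (t - 1) ≤ (1 / 2) ^ t * (a + b) := by rwa [hpow]
      exact le_of_mul_le_mul_left this (by positivity)
    have ht' := two_mul_sub_two_le_two_pow ht
    have hgt' : (g : ℝ) ≤ 2 * t + 1 := by exact_mod_cast htg
    have ht3 : (3 : ℝ) ≤ t := by exact_mod_cast ht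
    linarith

lemma sub_one_le_gapCredit {p : ℕ} {b : ℝ} (h : 1 / 2 ≤ (1 / 2 : ℝ) ^ p * b) :
    (p : ℝ) - 1 ≤ gapCredit b := by
  rcases Nat.lt_or_ge p 2 with hp | hp
  · have : (p : ℝ) ≤ 1 := by exact_mod_cast Nat.le_of_lt_succ hp
    linarith [gapCredit_nonneg b]
  obtain ⟨k, rfl⟩ : ∃ k, p = k + 2 := ⟨p - 2, by omega⟩
  have hb : (2 : ℝ) ^ (k + 1) ≤ b := by
    have e : (1 / 2 : ℝ) ^ (k + 2) * 2 ^ (k + 1) = 1 / 2 := by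
      rw [pow_succ, mul_right_comm, ← mul_pow]
      norm_num
    have : (1 / 2 : ℝ) ^ (k + 2) * 2 ^ (k + 1) ≤ (1 / 2) ^ (k + 2) * b := by rwa [e]
    exact le_of_mul_le_mul_left this (by positivity)
  have hk : (k : ℝ) + 1 ≤ 2 ^ k := by exact_mod_cast Nat.lt_two_pow_self
  have hk0 : (0 : ℝ) ≤ k := k.cast_nonneg
  rw [pow_succ] at hb
  push_cast
  linarith [le_gapCredit b]

/-- The potential at `y` of the points `x 0, …, x k` lying to the left of `y`. -/
noncomputable def leftPotential (x : ℕ → ℕ) (k y : ℕ) : ℝ :=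
  ∑ i ∈ Finset.range (k + 1), (1 / 2 : ℝ) ^ (y - x i)

/-- The potential at `y` of the points `x k, …, x (n - 1)` lying to the right of `y`. -/
noncomputable def rightPotential (x : ℕ → ℕ) (n k y : ℕ) : ℝ :=
  ∑ i ∈ Finset.Ico k n, (1 / 2 : ℝ) ^ (x i - y)

section Potential

variable {x : ℕ → ℕ} {n k y : ℕ}

lemma leftPotential_eq (hx : Monotone x) (hy : x k ≤ y) :
    leftPotential x k y = (1 / 2) ^ (y - x k) * leftPotential x k (x k) := by
  unfold leftPotential
  rw [Finset.mul_sum]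
  refine Finset.sum_congr rfl fun i hi => ?_
  have := hx (Nat.le_of_lt_succ (Finset.mem_range.1 hi))
  rw [← pow_add]
  congr 1
  omega

lemma rightPotential_eq (hx : Monotone x) (hy : y ≤ x k) :
    rightPotential x n k y = (1 / 2) ^ (x k - y) * rightPotential x n k (x k) := by
  unfold rightPotential
  rw [Finset.mul_sum]
  refine Finset.sum_congr rfl fun i hi => ?_
  have := hx (Finset.mem_Ico.1 hi).1
  rw [← pow_add]
  congr 1
  omega

lemma leftPotential_succ (hx : Monotone x) : leftPotential x (k + 1) (x (k + 1)) =
    1 + (1 / 2) ^ (x (k + 1) - x k) * leftPotential x k (x k) := by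
  rw [← leftPotential_eq hx (hx k.le_succ), leftPotential, Finset.sum_range_succ]
  simp [leftPotential, add_comm]

lemma rightPotential_of_lt (hx : Monotone x) (hk : k < n) : rightPotential x n k (x k) =
    1 + (1 / 2) ^ (x (k + 1) - x k) * rightPotential x n (k + 1) (x (k + 1)) := by
  rw [← rightPotential_eq hx (hx k.le_succ), rightPotential, Finset.sum_eq_sum_Ico_succ_bot hk]
  simp [rightPotential]

lemma one_le_leftPotential : 1 ≤ leftPotential x k (x k) := by
  unfold leftPotential
  rw [Finset.sum_range_succ, Nat.sub_self, pow_zero]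
  exact le_add_of_nonneg_left (Finset.sum_nonneg fun _ _ => by positivity)

lemma one_le_rightPotential (hk : k < n) : 1 ≤ rightPotential x n k (x k) := by
  unfold rightPotential
  rw [Finset.sum_eq_sum_Ico_succ_bot hk, Nat.sub_self, pow_zero]
  exact le_add_of_nonneg_right (Finset.sum_nonneg fun _ _ => by positivity)

lemma sum_range_eq_leftPotential (hx : Monotone x) (hy : x k ≤ y) :
    ∑ i ∈ Finset.range (k + 1), (1 / 2 : ℝ) ^ ((y - x i) + (x i - y)) = leftPotential x k y := by
  refine Finset.sum_congr rfl fun i hi => ?_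
  have := hx (Nat.le_of_lt_succ (Finset.mem_range.1 hi))
  congr 1
  omega

lemma sum_Ico_eq_rightPotential (hx : Monotone x) (hy : y ≤ x k) :
    ∑ i ∈ Finset.Ico k n, (1 / 2 : ℝ) ^ ((y - x i) + (x i - y)) = rightPotential x n k y := by
  refine Finset.sum_congr rfl fun i hi => ?_
  have := hx (Finset.mem_Ico.1 hi).1
  congr 1
  omega

end Potential

/-- If `n` points of `{0, …, d}`, each contributing `2 * (1 / 2) ^ r` at distance `r`, give weight
at least `1` to every element of `{0, …, d}`, then `d + 2 ≤ 4 * n`. -/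
lemma add_two_le_four_mul_of_monotone {x : ℕ → ℕ} (hx : Monotone x) {n d : ℕ} (hn : 0 < n)
    (hxd : ∀ i, x i ≤ d)
    (hdom : ∀ y ≤ d, 1 / 2 ≤ ∑ i ∈ Finset.range n, (1 / 2 : ℝ) ^ ((y - x i) + (x i - y))) :
    (d : ℝ) + 2 ≤ 4 * n := by
  obtain ⟨m, rfl⟩ : ∃ m, n = m + 1 := ⟨n - 1, by omega⟩
  have hgap : ∀ k ≤ m, (x k : ℝ) - x 0 - 4 * k + gapCredit (leftPotential x k (x k)) +
      gapCredit (rightPotential x (m + 1) 0 (x 0)) ≤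
      gapCredit (rightPotential x (m + 1) k (x k)) := by
    intro k
    induction k with
    | zero => intro _; simp [leftPotential, gapCredit_one]
    | succ k ih =>
      intro hk
      have hle := hx k.le_succ
      have key := gap_le_gapCredit (g := x (k + 1) - x k)
        (one_le_leftPotential (x := x) (k := k))
        (one_le_rightPotential (x := x) (show k + 1 < m + 1 by omega)) fun y hy0 hy => by
          have h := hdom (x k + y) (by have := hxd (k + 1); omega)
          rw [← Finset.sum_range_add_sum_Ico _ (show k + 1 ≤ m + 1 by omega),
            sum_range_eq_leftPotential hx (by omega), sum_Ico_eq_rightPotential hx (by omega),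
            leftPotential_eq hx (by omega), rightPotential_eq hx (by omega)] at h
          convert h using 4 <;> omega
      rw [← leftPotential_succ hx, ← rightPotential_of_lt hx (by omega), Nat.cast_sub hle] at key
      have := ih (by omega)
      push_cast
      linarith
  have hleft : (x 0 : ℝ) - 1 ≤ gapCredit (rightPotential x (m + 1) 0 (x 0)) := by
    apply sub_one_le_gapCredit
    have h := hdom 0 (Nat.zero_le d)
    rwa [Finset.range_eq_Ico, sum_Ico_eq_rightPotential hx (Nat.zero_le _),
      rightPotential_eq hx (Nat.zero_le _)] at h
  have hright : ((d - x m : ℕ) : ℝ) - 1 ≤ gapCredit (leftPotential x m (x m)) := by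
    apply sub_one_le_gapCredit
    have h := hdom d le_rfl
    rwa [sum_range_eq_leftPotential hx (hxd m), leftPotential_eq hx (hxd m)] at h
  rw [Nat.cast_sub (hxd m)] at hright
  have hlast : gapCredit (rightPotential x (m + 1) m (x m)) = 0 := by
    simp [rightPotential, gapCredit_one]
  have := hgap m le_rfl
  push_cast
  linarith

lemma add_two_le_four_mul_card {α : Type*} {S : Finset α} {f : α → ℕ} {d : ℕ}
    (hf : ∀ v, f v ≤ d)
    (hdom : ∀ y ≤ d, 1 / 2 ≤ ∑ v ∈ S, (1 / 2 : ℝ) ^ ((y - f v) + (f v - y))) :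
    (d : ℝ) + 2 ≤ 4 * S.card := by
  have hpos : 0 < S.card := by
    rw [Finset.card_pos, Finset.nonempty_iff_ne_empty]
    rintro rfl
    have := hdom 0 (Nat.zero_le d)
    norm_num at this
  let x : Fin S.card → ℕ := fun i => f (S.equivFin.symm i)
  let idx : ℕ → Fin S.card := fun k => ⟨min k (S.card - 1), by omega⟩
  have hmono : Monotone fun k => x (Tuple.sort x (idx k)) :=
    (Tuple.monotone_sort x).comp fun a b hab => by
      simp only [idx, Fin.mk_le_mk]
      omega
  refine add_two_le_four_mul_of_monotone hmono hpos (fun i => hf _) fun y hy => ?_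
  convert hdom y hy using 1
  rw [Finset.sum_range, ← Finset.sum_coe_sort S, ← S.equivFin.symm.sum_comp,
    ← Equiv.sum_comp (Tuple.sort x) fun i : Fin S.card =>
      (1 / 2 : ℝ) ^ ((y - f (S.equivFin.symm i)) + (f (S.equivFin.symm i) - y))]
  refine Finset.sum_congr rfl fun i _ => ?_
  have hi : idx i = i := Fin.ext (by simp only [idx]; omega)
  simp only [hi, x]

lemma expStep_nonneg (e : ℕ∞) : 0 ≤ expStep e := by
  unfold expStep
  split_ifs <;> positivity

lemma expStep_natCast (m : ℕ) : expStep m = 2 * (1 / 2) ^ m := by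
  have h : (m : ℕ∞) ≠ ⊤ := ENat.natCast_ne_top m
  have e : (m : ℕ∞).untop h = m := rfl
  rw [expStep, dif_neg h, e, zpow_sub₀ (by norm_num)]
  norm_num
  ring

lemma expStep_le {e : ℕ∞} {m : ℕ} (h : (m : ℕ∞) ≤ e) : expStep e ≤ 2 * (1 / 2) ^ m := by
  induction e using ENat.recTopCoe with
  | top => simp [expStep]
  | coe k =>
    rw [expStep_natCast]
    gcongr 2 * ?_
    exact pow_le_pow_of_le_one (by norm_num) (by norm_num) (by exact_mod_cast h)

lemma expDist_self {V : Type*} (G : SimpleGraph V) (S : Finset V) (u : V) :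
    expDist G S u u = 0 := by
  unfold expDist
  exact le_antisymm (sInf_le ⟨Walk.nil, by simp, by simp⟩) zero_le

lemma dist_le_expDist {V : Type*} (G : SimpleGraph V) (S : Finset V) (u v : V) :
    (G.dist u v : ℕ∞) ≤ expDist G S u v := by
  refine le_sInf ?_
  rintro _ ⟨p, -, rfl⟩
  exact_mod_cast dist_le p

lemma isExpDomSet_univ {V : Type*} [Fintype V] (G : SimpleGraph V) :
    IsExpDomSet G Finset.univ := by
  intro u
  calc (1 : ℝ) ≤ expStep (expDist G Finset.univ u u) := by
        rw [expDist_self, ← Nat.cast_zero, expStep_natCast]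
        norm_num
    _ ≤ expWeight G Finset.univ u :=
        Finset.single_le_sum (f := fun v => expStep (expDist G Finset.univ u v))
          (fun _ _ => expStep_nonneg _) (Finset.mem_univ u)

lemma exists_isExpDomSet_card_eq {V : Type*} [Fintype V] (G : SimpleGraph V) :
    ∃ S : Finset V, IsExpDomSet G S ∧ S.card = expDomNum G :=
  Nat.sInf_mem (s := {k | ∃ S : Finset V, IsExpDomSet G S ∧ S.card = k})
    ⟨_, Finset.univ, isExpDomSet_univ G, rfl⟩

lemma SimpleGraph.Connected.exists_dist_eq_of_le {V : Type*} {G : SimpleGraph V}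
    (hG : G.Connected) {a b : V} {i : ℕ} (hi : i ≤ G.dist a b) : ∃ u, G.dist a u = i := by
  obtain ⟨p, hp⟩ := hG.exists_walk_length_eq_dist a b
  refine ⟨p.getVert i, le_antisymm ?_ ?_⟩
  · calc G.dist a (p.getVert i) ≤ (p.take i).length := dist_le _
      _ ≤ i := by simp [Walk.take_length]
  · have h₁ : G.dist (p.getVert i) b ≤ p.length - i := by
      simpa using dist_le (p.drop i)
    have h₂ := hG.dist_triangle (u := a) (v := p.getVert i) (w := b)
    omega

/-- Dankelmann et al.: for a connected graph `G` of diameter `diam(G)`,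
`γ_e(G) ≥ (diam(G) + 2)/4`. -/
theorem expDomNum_lower_bound_diam {V : Type*} [Fintype V] [Nonempty V]
    (G : SimpleGraph V) (hG : G.Connected) :
    ((G.diam : ℝ) + 2) / 4 ≤ (expDomNum G : ℝ) := by
  obtain ⟨S, hS, hcard⟩ := exists_isExpDomSet_card_eq G
  obtain ⟨a, b, hab⟩ := G.exists_dist_eq_diam
  have hdist : ∀ v, G.dist a v ≤ G.diam :=
    fun v => dist_le_diam (connected_iff_ediam_ne_top.1 hG)
  have key := add_two_le_four_mul_card (S := S) hdist fun y hy => by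
    obtain ⟨u, rfl⟩ := hG.exists_dist_eq_of_le (hab.symm ▸ hy)
    have hle : expWeight G S u ≤ ∑ v ∈ S,
        2 * (1 / 2 : ℝ) ^ ((G.dist a u - G.dist a v) + (G.dist a v - G.dist a u)) := by
      refine Finset.sum_le_sum fun v _ => expStep_le (le_trans ?_ (dist_le_expDist G S u v))
      have h₁ := hG.dist_triangle (u := a) (v := u) (w := v)
      have h₂ := hG.dist_triangle (u := a) (v := v) (w := u)
      rw [G.dist_comm (u := v) (v := u)] at h₂
      exact_mod_cast (by omega)
    rw [← Finset.mul_sum] at hle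
    linarith [hS u]
  rw [← hcard]
  linarith
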